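/- Let ν, α, β > 0, let X ~ Gamma(ν,1) and Y ~ Gamma(α,1) be independent, set T = X/Y, and let Z be a standard d-dimensional Gaussian vector independent of (X,Y). Then the random vector W = Z/(β√T) has density f_W(w) = [Γ(ν + d/2) / ((2π)^(d/2) B(ν,α))] · β^d · U(ν + d/2, 1 - α + d/2, β²‖w‖²/2) for all w ∈ ℝ^d, where U is Tricomi's confluent hypergeometric function. -/

import Mathlib

open MeasureTheory ProbabilityTheory Real Set
open scoped ENNReal

/-- Tricomi's confluent hypergeometric function `U(a,b,z)` via its integral representation. -/
noncomputable def tricomiU (a b z : ℝ) : ℝ :=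
  (1 / Real.Gamma a) *
    ∫ t in Set.Ioi (0 : ℝ), Real.exp (-z * t) * t ^ (a - 1) * (1 + t) ^ (b - a - 1)

/-- The standard Gaussian measure on `ℝ^d`, with density `(2π)^(-d/2) exp(-‖z‖²/2)`. -/
noncomputable def stdGaussian (d : ℕ) : Measure (EuclideanSpace ℝ (Fin d)) :=
  volume.withDensity (fun z =>
    ENNReal.ofReal ((2 * π) ^ (-(d : ℝ) / 2) * Real.exp (-‖z‖ ^ 2 / 2)))

/-- Rescaling a Lebesgue integral over a normed space by a positive factor. -/
theorem lintegral_comp_inv_smul {E : Type*} [NormedAddCommGroup E] [NormedSpace ℝ E]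
    [MeasurableSpace E] [BorelSpace E] [FiniteDimensional ℝ E] (μ : Measure E)
    [μ.IsAddHaarMeasure] {c : ℝ} (hc : 0 < c) (f : E → ℝ≥0∞) :
    ∫⁻ x, f (c⁻¹ • x) ∂μ = ENNReal.ofReal (c ^ Module.finrank ℝ E) * ∫⁻ x, f x ∂μ := by
  have hc' : c⁻¹ ≠ 0 := (inv_pos.mpr hc).ne'
  have h := (Homeomorph.smulOfNeZero c⁻¹ hc').measurableEmbedding.lintegral_map (μ := μ) f
  refine h.symm.trans ?_
  change ∫⁻ x, f x ∂(Measure.map (c⁻¹ • ·) μ) = _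
  rw [Measure.map_addHaar_smul μ hc', lintegral_smul_measure, inv_pow, inv_inv,
    abs_of_pos (pow_pos hc _), smul_eq_mul]

theorem setLIntegral_Ioi_zero_comp_mul {c : ℝ} (hc : 0 < c) (f : ℝ → ℝ≥0∞) :
    ∫⁻ x in Ioi 0, f x = ENNReal.ofReal c * ∫⁻ t in Ioi 0, f (c * t) := by
  rw [← lintegral_indicator measurableSet_Ioi, ← lintegral_indicator measurableSet_Ioi]
  have h := lintegral_comp_inv_smul (volume : Measure ℝ) hc
    ((Ioi (0 : ℝ)).indicator fun t => f (c * t))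
  rw [Module.finrank_self, pow_one] at h
  rw [← h]
  refine lintegral_congr fun x => ?_
  simp only [indicator, mem_Ioi, smul_eq_mul, mul_inv_cancel_left₀ hc.ne',
    mul_pos_iff_of_pos_left (inv_pos.mpr hc)]

theorem lintegral_gammaMeasure_one {a : ℝ} {g : ℝ → ℝ≥0∞} (hg : Measurable g) :
    ∫⁻ x, g x ∂(gammaMeasure a 1) =
      ∫⁻ x in Ioi 0, ENNReal.ofReal (1 / Real.Gamma a * x ^ (a - 1) * Real.exp (-x)) * g x := by
  have hm : Measurable (gammaPDF a 1) := (measurable_gammaPDFReal a 1).ennreal_ofReal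
  rw [gammaMeasure, lintegral_withDensity_eq_lintegral_mul _ hm hg, ← setLIntegral_univ,
    ← Iio_union_Ici (a := (0 : ℝ)),
    lintegral_union measurableSet_Ici (by simp [Set.disjoint_left]),
    setLIntegral_congr_fun (g := fun _ => 0) measurableSet_Iio
      (fun x hx => by simp [gammaPDF_of_neg hx]),
    lintegral_zero, zero_add, setLIntegral_congr Ioi_ae_eq_Ici.symm]
  refine setLIntegral_congr_fun measurableSet_Ioi fun x hx => ?_
  simp [gammaPDF_of_nonneg (le_of_lt (mem_Ioi.mp hx))]

/-- The ratio of independent `Gamma(ν,1)` and `Gamma(α,1)` variables has the beta prime law. -/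
theorem lintegral_gammaMeasure_div {ν α : ℝ} (hν : 0 < ν) (hα : 0 < α) {H : ℝ → ℝ≥0∞}
    (hH : Measurable H) :
    ∫⁻ x, ∫⁻ y, H (x / y) ∂(gammaMeasure α 1) ∂(gammaMeasure ν 1) =
      ∫⁻ t in Ioi 0, ENNReal.ofReal (t ^ (ν - 1) * (1 + t) ^ (-(ν + α)) /
        (Real.Gamma ν * Real.Gamma α / Real.Gamma (ν + α))) * H t := by
  have hΓν := Real.Gamma_pos_of_pos hν
  have hΓα := Real.Gamma_pos_of_pos hα
  have : SFinite (gammaMeasure ν 1) := by unfold gammaMeasure; infer_instance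
  have : SFinite (gammaMeasure α 1) := by unfold gammaMeasure; infer_instance
  rw [lintegral_lintegral_swap (by fun_prop), lintegral_gammaMeasure_one (by fun_prop)]
  let p : ℝ → ℝ → ℝ := fun y t =>
    1 / (Real.Gamma ν * Real.Gamma α) * t ^ (ν - 1) *
      (y ^ (ν + α - 1) * Real.exp (-((1 + t) * y)))
  have hinner : ∀ y ∈ Ioi (0 : ℝ),
      ENNReal.ofReal (1 / Real.Gamma α * y ^ (α - 1) * Real.exp (-y)) *
        ∫⁻ x, H (x / y) ∂(gammaMeasure ν 1) =
      ∫⁻ t in Ioi 0, ENNReal.ofReal (p y t) * H t := by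
    intro y hy
    have hy : 0 < y := hy
    rw [lintegral_gammaMeasure_one (by fun_prop), setLIntegral_Ioi_zero_comp_mul hy,
      ← mul_assoc, ← ENNReal.ofReal_mul (by positivity),
      ← lintegral_const_mul _ (by fun_prop)]
    refine setLIntegral_congr_fun measurableSet_Ioi fun t ht => ?_
    have ht : 0 < t := ht
    rw [mul_div_cancel_left₀ _ hy.ne', ← mul_assoc, ← ENNReal.ofReal_mul (by positivity)]
    congr 2
    simp only [p]
    rw [Real.mul_rpow hy.le ht.le,
      show ν + α - 1 = (ν - 1) + (α - 1) + 1 by ring, Real.rpow_add_one hy.ne',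
      Real.rpow_add hy, show -((1 + t) * y) = -y + -(y * t) by ring, Real.exp_add]
    field_simp
  rw [setLIntegral_congr_fun measurableSet_Ioi hinner, lintegral_lintegral_swap (by fun_prop)]
  refine setLIntegral_congr_fun measurableSet_Ioi fun t ht => ?_
  have ht : 0 < t := ht
  have ht1 : 0 < 1 + t := by linarith
  rw [lintegral_mul_const _ (by fun_prop)]
  congr 1
  have hint : IntegrableOn (fun y : ℝ => y ^ (ν + α - 1) * Real.exp (-((1 + t) * y))) (Ioi 0) := by
    simpa only [Real.rpow_one, neg_mul] using
      integrableOn_rpow_mul_exp_neg_mul_rpow (s := ν + α - 1) (p := 1) (by linarith) one_pos ht1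
  rw [← ofReal_integral_eq_lintegral_ofReal (hint.const_mul _)
    ((ae_restrict_iff' measurableSet_Ioi).mpr (ae_of_all _ fun y (hy : 0 < y) => by
      dsimp only [p, Pi.zero_apply]; positivity)), integral_const_mul,
    Real.integral_rpow_mul_exp_neg_mul_Ioi (by linarith) ht1, one_div (1 + t),
    Real.inv_rpow ht1.le, Real.rpow_neg ht1.le]
  congr 1
  have := Real.Gamma_pos_of_pos (add_pos hν hα)
  field_simp

theorem lintegral_stdGaussian_comp_inv_smul (d : ℕ) {c : ℝ} (hc : 0 < c)
    {g : EuclideanSpace ℝ (Fin d) → ℝ≥0∞} (hg : Measurable g) :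
    ∫⁻ z, g (c⁻¹ • z) ∂(_root_.stdGaussian d) =
      ∫⁻ w, ENNReal.ofReal ((2 * π) ^ (-(d : ℝ) / 2) * c ^ (d : ℝ) *
        Real.exp (-(c ^ 2 * ‖w‖ ^ 2 / 2))) * g w := by
  rw [_root_.stdGaussian, lintegral_withDensity_eq_lintegral_mul _ (by fun_prop) (by fun_prop)]
  have h := lintegral_comp_inv_smul (volume : Measure (EuclideanSpace ℝ (Fin d))) hc fun w =>
    ENNReal.ofReal ((2 * π) ^ (-(d : ℝ) / 2) * Real.exp (-‖c • w‖ ^ 2 / 2)) * g w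
  simp only [smul_inv_smul₀ hc.ne'] at h
  simp only [Pi.mul_apply]
  rw [h, ← lintegral_const_mul _ (by fun_prop)]
  refine lintegral_congr fun w => ?_
  rw [← mul_assoc, ← ENNReal.ofReal_mul (by positivity), finrank_euclideanSpace_fin, norm_smul,
    Real.norm_of_nonneg hc.le, Real.rpow_natCast]
  congr 2
  rw [show -(c * ‖w‖) ^ 2 / 2 = -(c ^ 2 * ‖w‖ ^ 2 / 2) by ring]
  ring

/-- The integral representation of `tricomiU` as a Lebesgue integral. -/
theorem ofReal_Gamma_mul_tricomiU {a b z : ℝ} (ha : 0 < a) (hb : b - a - 1 ≤ 0) (hz : 0 < z) :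
    ENNReal.ofReal (Real.Gamma a * tricomiU a b z) =
      ∫⁻ t in Ioi 0, ENNReal.ofReal
        (Real.exp (-z * t) * t ^ (a - 1) * (1 + t) ^ (b - a - 1)) := by
  rw [tricomiU, ← mul_assoc, mul_one_div_cancel (Real.Gamma_pos_of_pos ha).ne', one_mul]
  refine ofReal_integral_eq_lintegral_ofReal ?_
    ((ae_restrict_iff' measurableSet_Ioi).mpr (ae_of_all _ fun t (ht : 0 < t) => by
      dsimp only [Pi.zero_apply]; positivity))
  have hint : IntegrableOn (fun t : ℝ => t ^ (a - 1) * Real.exp (-z * t)) (Ioi 0) := by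
    simpa only [Real.rpow_one] using
      integrableOn_rpow_mul_exp_neg_mul_rpow (s := a - 1) (p := 1) (by linarith) one_pos hz
  refine hint.mono' (by fun_prop)
    ((ae_restrict_iff' measurableSet_Ioi).mpr (ae_of_all _ fun t (ht : 0 < t) => ?_))
  rw [Real.norm_of_nonneg (by positivity), mul_comm (Real.exp _)]
  exact mul_le_of_le_one_right (by positivity)
    (Real.rpow_le_one_of_one_le_of_nonpos (by linarith) hb)

/-- Mixing Gaussian densities of covariance `(β² t)⁻¹ I` over the beta prime law of `t`. -/
theorem lintegral_betaPrime_mul_gaussian (d : ℕ) {ν α β r : ℝ} (hν : 0 < ν) (hα : 0 < α)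
    (hβ : 0 < β) (hr : 0 < r) :
    ∫⁻ t in Ioi 0, ENNReal.ofReal (t ^ (ν - 1) * (1 + t) ^ (-(ν + α)) /
        (Real.Gamma ν * Real.Gamma α / Real.Gamma (ν + α))) *
      ENNReal.ofReal ((2 * π) ^ (-(d : ℝ) / 2) * (β * √t) ^ (d : ℝ) *
        Real.exp (-((β * √t) ^ 2 * r ^ 2 / 2))) =
    ENNReal.ofReal (Real.Gamma (ν + d / 2) /
        ((2 * π) ^ ((d : ℝ) / 2) * (Real.Gamma ν * Real.Gamma α / Real.Gamma (ν + α))) *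
      β ^ (d : ℝ) * tricomiU (ν + d / 2) (1 - α + d / 2) (β ^ 2 * r ^ 2 / 2)) := by
  have hΓν := Real.Gamma_pos_of_pos hν
  have hΓα := Real.Gamma_pos_of_pos hα
  have hΓ := Real.Gamma_pos_of_pos (add_pos hν hα)
  set B := Real.Gamma ν * Real.Gamma α / Real.Gamma (ν + α)
  have hBpos : 0 < B := by positivity
  rw [show ∀ U : ℝ, Real.Gamma (ν + d / 2) / ((2 * π) ^ ((d : ℝ) / 2) * B) * β ^ (d : ℝ) * U =
      β ^ (d : ℝ) / ((2 * π) ^ ((d : ℝ) / 2) * B) * (Real.Gamma (ν + d / 2) * U) by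
      intro U; ring,
    ENNReal.ofReal_mul (by positivity),
    ofReal_Gamma_mul_tricomiU (by positivity) (by linarith) (by positivity),
    ← lintegral_const_mul _ (by fun_prop)]
  refine setLIntegral_congr_fun measurableSet_Ioi fun t ht => ?_
  have ht : 0 < t := ht
  rw [← ENNReal.ofReal_mul (by positivity), ← ENNReal.ofReal_mul (by positivity)]
  congr 1
  rw [mul_pow, Real.sq_sqrt ht.le, Real.mul_rpow hβ.le (Real.sqrt_nonneg t), Real.sqrt_eq_rpow,
    ← Real.rpow_mul ht.le, neg_div,
    Real.rpow_neg (x := 2 * π) (by positivity),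
    show ν + (d : ℝ) / 2 - 1 = (ν - 1) + 1 / 2 * d by ring, Real.rpow_add ht,
    show 1 - α + (d : ℝ) / 2 - (ν + d / 2) - 1 = -(ν + α) by ring,
    show -(β ^ 2 * t * r ^ 2 / 2) = -(β ^ 2 * r ^ 2 / 2) * t by ring]
  field_simp

/-- Let `X ~ Gamma(ν,1)`, `Y ~ Gamma(α,1)` be independent, `T = X/Y`, and `Z` a standard
`d`-dimensional Gaussian vector independent of `(X,Y)`. Then `W = Z/(β√T)` has the
isotropic density `Γ(ν+d/2)/((2π)^(d/2) B(ν,α)) · β^d · U(ν+d/2, 1-α+d/2, β²‖w‖²/2)`. -/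
theorem kummer_spectral_representation
    {Ω : Type*} [MeasureSpace Ω] [IsProbabilityMeasure (ℙ : Measure Ω)]
    (d : ℕ) (hd : 0 < d) (ν α β : ℝ) (hν : 0 < ν) (hα : 0 < α) (hβ : 0 < β)
    (X Y : Ω → ℝ) (Z : Ω → EuclideanSpace ℝ (Fin d))
    (hXm : Measurable X) (hYm : Measurable Y) (hZm : Measurable Z)
    (hX : Measure.map X ℙ = gammaMeasure ν 1)
    (hY : Measure.map Y ℙ = gammaMeasure α 1)
    (hZ : Measure.map Z ℙ = stdGaussian d)
    (hXY : IndepFun X Y ℙ)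
    (hXYZ : IndepFun (fun ω => (X ω, Y ω)) Z ℙ) :
    Measure.map (fun ω => (β * Real.sqrt (X ω / Y ω))⁻¹ • Z ω) ℙ =
      volume.withDensity (fun w => ENNReal.ofReal
        (Real.Gamma (ν + d / 2) /
            ((2 * π) ^ ((d : ℝ) / 2) *
              (Real.Gamma ν * Real.Gamma α / Real.Gamma (ν + α))) *
          β ^ (d : ℝ) *
          tricomiU (ν + d / 2) (1 - α + d / 2) (β ^ 2 * ‖w‖ ^ 2 / 2))) := by
  refine Measure.ext_of_lintegral _ fun g hg => ?_
  have hsY : SFinite (gammaMeasure α 1) := by unfold gammaMeasure; infer_instance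
  have hsZ : SFinite (_root_.stdGaussian d) := by unfold _root_.stdGaussian; infer_instance
  have hXYlaw := hXY.map_prod_eq_prod_map_map hXm.aemeasurable hYm.aemeasurable
  have hlaw := hXYZ.map_prod_eq_prod_map_map (hXm.prodMk hYm).aemeasurable hZm.aemeasurable
  rw [hXYlaw, hX, hY, hZ] at hlaw
  let H : ℝ → ℝ≥0∞ := fun t => ∫⁻ z, g ((β * √t)⁻¹ • z) ∂(_root_.stdGaussian d)
  have hH : Measurable H := Measurable.lintegral_prod_right (by fun_prop)
  have hleft : ∫⁻ w, g w ∂(Measure.map (fun ω => (β * √(X ω / Y ω))⁻¹ • Z ω) ℙ) =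
      ∫⁻ x, ∫⁻ y, H (x / y) ∂(gammaMeasure α 1) ∂(gammaMeasure ν 1) := by
    rw [lintegral_map hg (by fun_prop)]
    have hmap := lintegral_map (μ := (ℙ : Measure Ω))
      (f := fun q : (ℝ × ℝ) × EuclideanSpace ℝ (Fin d) => g ((β * √(q.1.1 / q.1.2))⁻¹ • q.2))
      (by fun_prop) ((hXm.prodMk hYm).prodMk hZm)
    rw [← hmap, hlaw, lintegral_prod _ (by fun_prop)]
    exact lintegral_prod _ (hH.comp (measurable_fst.div measurable_snd)).aemeasurable
  rw [hleft, lintegral_gammaMeasure_div hν hα hH]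
  have hscale : ∀ t ∈ Ioi (0 : ℝ), _ = _ := fun t (ht : 0 < t) =>
    congrArg (ENNReal.ofReal (t ^ (ν - 1) * (1 + t) ^ (-(ν + α)) /
        (Real.Gamma ν * Real.Gamma α / Real.Gamma (ν + α))) * ·)
      ((lintegral_stdGaussian_comp_inv_smul d (mul_pos hβ (Real.sqrt_pos.mpr ht)) hg).trans rfl)
  rw [setLIntegral_congr_fun measurableSet_Ioi hscale]
  simp_rw [← lintegral_const_mul' _ _ ENNReal.ofReal_ne_top]
  have : Nonempty (Fin d) := ⟨⟨0, hd⟩⟩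
  have hdens : ∀ᵐ w : EuclideanSpace ℝ (Fin d), _ = _ :=
    (Measure.ae_ne volume (0 : EuclideanSpace ℝ (Fin d))).mono fun w hw =>
      lintegral_betaPrime_mul_gaussian d hν hα hβ (norm_pos_iff.mpr hw)
  rw [lintegral_lintegral_swap (by fun_prop), withDensity_congr_ae (hdens.mono fun _ h => h.symm),
    lintegral_withDensity_eq_lintegral_mul _ (Measurable.lintegral_prod_right (by fun_prop)) hg]
  refine lintegral_congr fun w => ?_
  simp only [← mul_assoc, Pi.mul_apply]
  exact lintegral_mul_const _ (by fun_prop)
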